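/- For every w∈W with ℓ(w)=n and every reduced word (i_1,…,i_n) of w, the map K^n→𝔘(K) sending (a_1,…,a_n) to i_1^{a_1} i_2^{a_2} ⋯ i_n^{a_n} is injective. -/

import Mathlib

open FreeMonoid

/-- The minimum of two elements of an additive subgroup of `ℝ`
(the "sum" in the tropical semifield `K`). -/
noncomputable def kmin {K : AddSubgroup ℝ} (a b : K) : K :=
  if (a : ℝ) ≤ (b : ℝ) then a else b

/-- Defining relations of the monoid `𝔘(K)` attached to a simply laced Coxeter matrix `M`
and the tropical semifield `K` (a subgroup of `(ℝ, +)` with sum `min` and product `+`). -/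
inductive UKRel {I : Type*} (M : CoxeterMatrix I) (K : AddSubgroup ℝ) :
    FreeMonoid (I × K) → FreeMonoid (I × K) → Prop
  | comm (i j : I) (h : M i j = 2) (a b : K) :
      UKRel M K (of (i, a) * of (j, b)) (of (j, b) * of (i, a))
  | braid (i j : I) (h : M i j = 3) (a b c : K) :
      UKRel M K (of (i, a) * of (j, b) * of (i, c))
        (of (j, b + c - kmin a c) * of (i, kmin a c) * of (j, a + b - kmin a c))
  | idem (i : I) (a b : K) :
      UKRel M K (of (i, a) * of (i, b)) (of (i, kmin a b))

/-- The monoid `𝔘(K)`. -/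
noncomputable def UK {I : Type*} (M : CoxeterMatrix I) (K : AddSubgroup ℝ) :=
  (conGen (UKRel M K)).Quotient

noncomputable instance {I : Type*} (M : CoxeterMatrix I) (K : AddSubgroup ℝ) :
    Monoid (UK M K) := Con.monoid _

/-- The generator `i^a` of `𝔘(K)`. -/
noncomputable def genU {I : Type*} (M : CoxeterMatrix I) (K : AddSubgroup ℝ)
    (i : I) (a : K) : UK M K :=
  (Con.mk' _) (of (i, a))

/-- The product `i₁^{a₁} ⋯ i_n^{a_n}` in `𝔘(K)` associated to a list of pairs. -/
noncomputable def prodU {I : Type*} (M : CoxeterMatrix I) (K : AddSubgroup ℝ)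
    (ω : List (I × K)) : UK M K :=
  (ω.map fun p => genU M K p.1 p.2).prod

/-- `l` is a reduced word of `w`. -/
def IsRedWord {I W : Type*} [Group W] {M : CoxeterMatrix I} (cs : CoxeterSystem M W)
    (w : W) (l : List I) : Prop :=
  cs.wordProd l = w ∧ l.length = cs.length w

/-- The set `𝒰(K) = 𝔘_{w₀}(K)` of products over reduced words of `w₀`. -/
noncomputable def calU {I W : Type*} [Group W] (M : CoxeterMatrix I) (K : AddSubgroup ℝ)
    (cs : CoxeterSystem M W) (w₀ : W) : Set (UK M K) :=
  {u | ∃ ω : List (I × K), IsRedWord cs w₀ (ω.map Prod.fst) ∧ u = prodU M K ω}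

/-- The set `𝒰(K₊)`: products over reduced words of `w₀` with coefficients in `K₊ = K ∩ ℝ≥0`. -/
noncomputable def calUplus {I W : Type*} [Group W] (M : CoxeterMatrix I) (K : AddSubgroup ℝ)
    (cs : CoxeterSystem M W) (w₀ : W) : Set (UK M K) :=
  {u | ∃ ω : List (I × K), IsRedWord cs w₀ (ω.map Prod.fst) ∧
        (∀ p ∈ ω, 0 ≤ (p.2 : ℝ)) ∧ u = prodU M K ω}

/-- Two vertices of the graph on `𝒰(K)` are joined by an edge. -/
noncomputable def UEdge {I W : Type*} [Group W] (M : CoxeterMatrix I) (K : AddSubgroup ℝ)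
    (cs : CoxeterSystem M W) (w₀ : W) (H H' : UK M K) : Prop :=
  H ≠ H' ∧ ∃ (i : I) (b b' : K) (ω : List (I × K)),
    IsRedWord cs w₀ (i :: ω.map Prod.fst) ∧
    H = genU M K i b * prodU M K ω ∧ H' = genU M K i b' * prodU M K ω

/-- `H` and `H'` are at distance `≤ k` in the graph on `𝒰(K)`. -/
noncomputable def DistLE {I W : Type*} [Group W] (M : CoxeterMatrix I) (K : AddSubgroup ℝ)
    (cs : CoxeterSystem M W) (w₀ : W) (k : ℕ) (H H' : UK M K) : Prop :=
  ∃ f : ℕ → UK M K, f 0 = H ∧ f k = H' ∧ (∀ t ≤ k, f t ∈ calU M K cs w₀) ∧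
    ∀ t < k, f t = f (t + 1) ∨ UEdge M K cs w₀ (f t) (f (t + 1))

namespace CoxeterSystem

theorem end_mul_apply {α : Type*} (f g : Function.End α) (x : α) : (f * g) x = f (g x) := rfl

theorem end_one_apply {α : Type*} (x : α) : (1 : Function.End α) x = x := rfl

variable {I W : Type*} [Group W] {M : CoxeterMatrix I} (cs : CoxeterSystem M W)

open Classical in
/-- The permutation `(t, ε) ↦ (sᵢ t sᵢ, ε + [t = sᵢ])` behind the strong exchange property. -/
noncomputable def signedConj (i : I) : Function.End (W × ZMod 2) := fun p =>
  (cs.simple i * p.1 * cs.simple i, p.2 + if p.1 = cs.simple i then 1 else 0)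

open Classical in
theorem signedConj_mul_pow (i j : I) (n : ℕ) (t : W) (ε : ZMod 2) :
    ((cs.signedConj i * cs.signedConj j) ^ n) (t, ε) =
      ((cs.simple i * cs.simple j) ^ n * t * (cs.simple j * cs.simple i) ^ n,
        ε + ∑ k ∈ Finset.range (2 * n),
          if t = (cs.simple j * cs.simple i) ^ k * cs.simple j then 1 else 0) := by
  induction n generalizing t ε with
  | zero => simp [end_one_apply]
  | succ n ih =>
    rw [pow_succ, end_mul_apply, end_mul_apply, signedConj, signedConj, ih]
    refine Prod.ext ?_ ?_
    · simp only [pow_succ (cs.simple i * cs.simple j), pow_succ' (cs.simple j * cs.simple i),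
        mul_assoc]
    · dsimp only
      rw [mul_add, mul_one, Finset.sum_range_succ', Finset.sum_range_succ', add_assoc, add_assoc]
      congr 1
      have h1 : cs.simple j * t * cs.simple j = cs.simple i ↔
          t = (cs.simple j * cs.simple i) ^ (0 + 1) * cs.simple j := by
        constructor
        · intro h; rw [zero_add, pow_one, ← h]; simp [mul_assoc]
        · rintro rfl; simp [mul_assoc]
      have h2 : ∀ k, cs.simple i * (cs.simple j * t * cs.simple j) * cs.simple i =
            (cs.simple j * cs.simple i) ^ k * cs.simple j ↔
          t = (cs.simple j * cs.simple i) ^ (k + 1 + 1) * cs.simple j := by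
        intro k
        rw [pow_succ, pow_succ']
        constructor
        · intro h
          have := congrArg (fun x => cs.simple j * (cs.simple i * x * cs.simple i) * cs.simple j) h
          simpa [mul_assoc] using this
        · rintro rfl; simp [mul_assoc]
      simp only [h1, h2, pow_zero, one_mul]
      ring

theorem isLiftable_signedConj : M.IsLiftable cs.signedConj := by
  classical
  intro i j
  funext ⟨t, ε⟩
  have h1 := cs.simple_mul_simple_pow i j
  have h2 := cs.simple_mul_simple_pow' i j
  rw [signedConj_mul_pow, h1, h2, two_mul, Finset.sum_range_add]
  simp only [pow_add, h2, one_mul, mul_one, CharTwo.add_self_eq_zero, add_zero]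
  rfl

/-- The parity of the number of occurrences of `t` in the left inversion sequence of a word
of `w`. -/
noncomputable def invParity (w t : W) : ZMod 2 :=
  (cs.lift ⟨cs.signedConj, cs.isLiftable_signedConj⟩ w⁻¹ (t, 0)).2

theorem lift_signedConj_snd (w t : W) (ε : ZMod 2) :
    (cs.lift ⟨cs.signedConj, cs.isLiftable_signedConj⟩ w (t, ε)).2 =
      (cs.lift ⟨cs.signedConj, cs.isLiftable_signedConj⟩ w (t, 0)).2 + ε := by
  induction w using cs.simple_induction_right generalizing t ε with
  | one => simp [end_one_apply]
  | mul_simple_right w i ih =>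
    rw [map_mul, lift_apply_simple, end_mul_apply, end_mul_apply, signedConj,
      signedConj, ih, ih _ (0 + _)]
    ring

@[simp] theorem invParity_one (t : W) : cs.invParity 1 t = 0 := by
  simp [invParity, end_one_apply]

open Classical in
theorem invParity_simple_mul (i : I) (w t : W) :
    cs.invParity (cs.simple i * w) t =
      (if t = cs.simple i then 1 else 0) + cs.invParity w (cs.simple i * t * cs.simple i) := by
  rw [invParity, mul_inv_rev, inv_simple, map_mul, lift_apply_simple, end_mul_apply, signedConj,
    lift_signedConj_snd, invParity]
  ring

theorem invParity_mul (v w t : W) :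
    cs.invParity (v * w) t = cs.invParity v t + cs.invParity w (v⁻¹ * t * v) := by
  induction v using cs.simple_induction_left generalizing t with
  | one => simp
  | mul_simple_left v i ih =>
    rw [mul_assoc, invParity_simple_mul, ih, invParity_simple_mul]
    simp [mul_assoc, add_assoc]

theorem mem_leftInvSeq_of_invParity_ne_zero (l : List I) (t : W)
    (h : cs.invParity (cs.wordProd l) t ≠ 0) : t ∈ cs.leftInvSeq l := by
  induction l generalizing t with
  | nil => simp at h
  | cons i l ih =>
    rw [wordProd_cons, invParity_simple_mul] at h
    rw [leftInvSeq, List.mem_cons]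
    by_cases ht : t = cs.simple i
    · exact Or.inl ht
    · rw [if_neg ht, zero_add] at h
      exact Or.inr (List.mem_map.2 ⟨_, ih _ h, by simp [mul_assoc]⟩)

theorem invParity_self {t : W} (ht : cs.IsReflection t) : cs.invParity t t = 1 := by
  obtain ⟨u, i, rfl⟩ := ht
  have h := cs.invParity_mul u u⁻¹ (u * cs.simple i * u⁻¹)
  have h3 := cs.invParity_simple_mul i 1 (cs.simple i)
  simp only [mul_inv_cancel, invParity_one, mul_assoc, inv_mul_cancel, mul_one,
    inv_mul_cancel_left, if_true, add_zero] at h h3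
  rw [mul_assoc, invParity_mul, invParity_mul]
  simp only [mul_assoc, inv_simple, inv_mul_cancel, mul_one, inv_mul_cancel_left,
    simple_mul_simple_cancel_left, h3]
  rw [← add_assoc, add_comm _ (1 : ZMod 2), add_assoc, ← h, add_zero]

theorem length_mul_lt_of_invParity_ne_zero {w t : W} (h : cs.invParity w t ≠ 0) :
    cs.length (t * w) < cs.length w := by
  obtain ⟨l, hl, rfl⟩ := cs.exists_isReduced w
  exact (cs.isLeftInversion_of_mem_leftInvSeq hl
    (cs.mem_leftInvSeq_of_invParity_ne_zero l t h)).2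

theorem invParity_ne_zero_iff {w t : W} (ht : cs.IsReflection t) :
    cs.invParity w t ≠ 0 ↔ cs.length (t * w) < cs.length w := by
  refine ⟨cs.length_mul_lt_of_invParity_ne_zero, fun h h0 => ?_⟩
  have h1 : cs.invParity (t * w) t = 1 := by
    rw [invParity_mul, cs.invParity_self ht, mul_assoc, ht.mul_self, mul_one, ht.inv, h0, add_zero]
  have h2 := cs.length_mul_lt_of_invParity_ne_zero (h1.trans_ne one_ne_zero)
  rw [← mul_assoc, ht.mul_self, one_mul] at h2
  omega

theorem isLeftDescent_iff_invParity {w : W} {i : I} :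
    cs.IsLeftDescent w i ↔ cs.invParity w (cs.simple i) ≠ 0 :=
  (cs.invParity_ne_zero_iff (cs.isReflection_simple i)).symm

open Classical in
/-- The move at `i` of the numbers game on a simply laced graph. -/
noncomputable def numbersMove (M : CoxeterMatrix I) (i : I) : Function.End (I → ℤ) := fun c k =>
  if k = i then -c i else if M i k = 3 then c k + c i else c k

theorem isLiftable_numbersMove (hM : ∀ i j : I, i ≠ j → M i j = 2 ∨ M i j = 3) :
    M.IsLiftable (numbersMove M) := by
  intro i j
  by_cases hij : i = j
  · subst hij
    rw [M.diagonal, pow_one]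
    funext c k
    simp only [end_mul_apply, end_one_apply, numbersMove]
    split_ifs <;> simp_all
  · have hji := M.symmetric j i
    rcases hM i j hij with h | h <;> rw [h] at hji ⊢ <;> funext c k <;>
    · simp only [pow_succ, pow_zero, one_mul, end_mul_apply, end_one_apply,
        numbersMove, h, hji, hij, Ne.symm hij, if_true, if_false]
      grind

theorem simple_ne_simple (hM : ∀ i j : I, i ≠ j → M i j = 2 ∨ M i j = 3) {i j : I}
    (hij : i ≠ j) : cs.simple i ≠ cs.simple j := by
  classical
  intro h
  have h1 := congrArg (cs.lift ⟨_, isLiftable_numbersMove hM⟩) h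
  rw [lift_apply_simple, lift_apply_simple] at h1
  have h2 := congrFun (congrFun h1 (Pi.single i 1)) i
  simp [numbersMove, hij, hij.symm] at h2

theorem simple_mul_comm {i j : I} (h : M i j = 2) :
    cs.simple i * cs.simple j = cs.simple j * cs.simple i := by
  have h1 := cs.simple_mul_simple_pow i j
  rw [h, pow_two] at h1
  simpa using mul_eq_one_iff_eq_inv.1 h1

theorem simple_mul_braid {i j : I} (h : M i j = 3) :
    cs.simple i * cs.simple j * cs.simple i = cs.simple j * cs.simple i * cs.simple j := by
  have h1 := cs.simple_mul_simple_pow i j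
  have h2 : cs.simple i * cs.simple j * cs.simple i *
      (cs.simple j * cs.simple i * cs.simple j) = 1 := by
    rw [← h1, h]
    simp only [pow_succ, pow_zero, one_mul, mul_assoc]
  simpa [mul_assoc] using mul_eq_one_iff_eq_inv.1 h2

theorem isLeftDescent_simple_mul_of_comm (hM : ∀ i j : I, i ≠ j → M i j = 2 ∨ M i j = 3)
    {i j : I} (h : M i j = 2) {w : W} :
    cs.IsLeftDescent (cs.simple i * w) j ↔ cs.IsLeftDescent w j := by
  have hij : i ≠ j := by rintro rfl; simp at h
  rw [isLeftDescent_iff_invParity, isLeftDescent_iff_invParity, invParity_simple_mul,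
    if_neg (cs.simple_ne_simple hM hij.symm), cs.simple_mul_comm h]
  simp [mul_assoc]

theorem isLeftDescent_simple_mul_of_braid (hM : ∀ i j : I, i ≠ j → M i j = 2 ∨ M i j = 3)
    {i j : I} (h : M i j = 3) {w : W} :
    cs.IsLeftDescent (cs.simple i * (cs.simple j * w)) j ↔ cs.IsLeftDescent w i := by
  have hij : i ≠ j := by rintro rfl; simp at h
  have hb := cs.simple_mul_braid h
  have hne : cs.simple i * cs.simple j * cs.simple i ≠ cs.simple j := by
    intro h'
    rw [hb, mul_assoc, mul_eq_left, ] at h'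
    exact cs.simple_ne_simple hM hij (by simpa using mul_eq_one_iff_eq_inv.1 h')
  rw [isLeftDescent_iff_invParity, isLeftDescent_iff_invParity, invParity_simple_mul,
    invParity_simple_mul, if_neg (cs.simple_ne_simple hM hij.symm), if_neg hne, hb]
  simp [mul_assoc]

theorem isLeftDescent_simple_mul_of_isLeftDescent
    (hM : ∀ i j : I, i ≠ j → M i j = 2 ∨ M i j = 3)
    {i j : I} (hij : i ≠ j) {w : W} (hi : cs.IsLeftDescent w i) (hj : cs.IsLeftDescent w j) :
    cs.IsLeftDescent (cs.simple i * w) j := by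
  rcases hM i j hij with h | h
  · exact (cs.isLeftDescent_simple_mul_of_comm hM h).2 hj
  · by_contra hn
    have h1 : cs.IsLeftDescent (cs.simple j * (cs.simple i * w)) i :=
      (cs.isLeftDescent_simple_mul_of_braid hM (by rw [M.symmetric, h])).2 hj
    have h2 := cs.isLeftDescent_iff.1 hi
    have h3 := cs.not_isLeftDescent_iff.1 hn
    have h4 := cs.isLeftDescent_iff.1 h1
    have ht : cs.IsReflection (cs.simple i * cs.simple j * cs.simple i) :=
      ⟨cs.simple i, j, by rw [inv_simple]⟩
    refine hn (cs.isLeftDescent_iff_invParity.2 ?_)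
    rw [invParity_simple_mul, if_neg (cs.simple_ne_simple hM hij.symm), zero_add]
    refine (cs.invParity_ne_zero_iff ht).2 ?_
    simp only [mul_assoc]
    omega

end CoxeterSystem

/-- `(p, q, r)` is the image of `(a, b, c)` under the tropical braid transformation. -/
def TropBraid (a b c p q r : ℝ) : Prop :=
  p + q = b + c ∧ q + r = a + b ∧ q = min a c

namespace TropBraid

theorem symm {a b c p q r : ℝ} (h : TropBraid a b c p q r) : TropBraid p q r a b c := by
  obtain ⟨h1, h2, h3⟩ := h
  refine ⟨by linarith, by linarith, ?_⟩
  rcases le_total a c with h | h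
  · rw [min_eq_left h] at h3; rw [min_eq_right] <;> linarith
  · rw [min_eq_right h] at h3; rw [min_eq_left] <;> linarith

theorem cases {a b c p q r : ℝ} (h : TropBraid a b c p q r) :
    (a ≤ c ∧ p = b + c - a ∧ q = a ∧ r = b) ∨ (c < a ∧ p = b ∧ q = c ∧ r = a + b - c) := by
  obtain ⟨h1, h2, h3⟩ := h
  rcases le_or_gt a c with h | h
  · rw [min_eq_left h] at h3; exact .inl ⟨h, by linarith, h3, by linarith⟩
  · rw [min_eq_right h.le] at h3; exact .inr ⟨h, by linarith, h3, by linarith⟩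

theorem unique {K : AddSubgroup ℝ} {a b c p q r p' q' r' : K} (h : TropBraid a b c p q r)
    (h' : TropBraid a b c p' q' r') : p = p' ∧ q = q' ∧ r = r' := by
  obtain ⟨h1, h2, h3⟩ := h
  obtain ⟨h1', h2', h3'⟩ := h'
  refine ⟨Subtype.ext ?_, Subtype.ext ?_, Subtype.ext ?_⟩ <;> linarith

end TropBraid

theorem coe_kmin {K : AddSubgroup ℝ} (a b : K) : ((kmin a b : K) : ℝ) = min (a : ℝ) b := by
  unfold kmin
  split_ifs with h
  · exact (min_eq_left h).symm
  · exact (min_eq_right (le_of_not_ge h)).symm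

theorem tropBraid_kmin {K : AddSubgroup ℝ} (a b c : K) :
    TropBraid a b c (b + c - kmin a c : K) (kmin a c : K) (a + b - kmin a c : K) := by
  refine ⟨?_, ?_, coe_kmin a c⟩ <;> push_cast <;> ring

theorem exists_tropBraid {K : AddSubgroup ℝ} (a b c : K) :
    ∃ p q r : K, TropBraid a b c p q r :=
  ⟨_, _, _, tropBraid_kmin a b c⟩

set_option maxHeartbeats 1000000 in
theorem tropBraid_loop₁ {a b c d e f p1 q1 r1 p2 q2 r2 p3 q3 r3 u1 v1 w1 u2 v2 w2 u3 v3 w3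
    x1 y1 z1 x2 y2 z2 : ℝ}
    (h1 : TropBraid b c e p1 q1 r1) (h2 : TropBraid r1 d f p2 q2 r2)
    (h3 : TropBraid a p1 p2 p3 q3 r3) (h4 : TropBraid a c d u1 v1 w1)
    (h5 : TropBraid w1 e f u2 v2 w2) (h6 : TropBraid b u1 u2 u3 v3 w3)
    (h7 : TropBraid r3 q1 q2 x1 y1 z1) (h8 : TropBraid q3 y1 r2 x2 y2 z2) :
    p3 = u3 ∧ x1 = v3 ∧ x2 = w3 ∧ y2 = v1 ∧ z2 = v2 ∧ z1 = w2 := by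
  rcases h1.cases with ⟨i1, rfl, rfl, rfl⟩ | ⟨i1, rfl, rfl, rfl⟩ <;> clear h1 <;>
  rcases h2.cases with ⟨i2, rfl, rfl, rfl⟩ | ⟨i2, rfl, rfl, rfl⟩ <;> clear h2 <;>
  rcases h3.cases with ⟨i3, rfl, rfl, rfl⟩ | ⟨i3, rfl, rfl, rfl⟩ <;> clear h3 <;>
  rcases h4.cases with ⟨i4, rfl, rfl, rfl⟩ | ⟨i4, rfl, rfl, rfl⟩ <;> clear h4 <;>
  (try (exfalso; linarith)) <;>
  rcases h5.cases with ⟨i5, rfl, rfl, rfl⟩ | ⟨i5, rfl, rfl, rfl⟩ <;> clear h5 <;>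
  (try (exfalso; linarith)) <;>
  rcases h6.cases with ⟨i6, rfl, rfl, rfl⟩ | ⟨i6, rfl, rfl, rfl⟩ <;> clear h6 <;>
  (try (exfalso; linarith)) <;>
  rcases h7.cases with ⟨i7, rfl, rfl, rfl⟩ | ⟨i7, rfl, rfl, rfl⟩ <;> clear h7 <;>
  (try (exfalso; linarith)) <;>
  rcases h8.cases with ⟨i8, rfl, rfl, rfl⟩ | ⟨i8, rfl, rfl, rfl⟩ <;> clear h8 <;>
  (try (exfalso; linarith)) <;>
  refine ⟨?_, ?_, ?_, ?_, ?_, ?_⟩ <;> linarith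

set_option maxHeartbeats 1000000 in
theorem tropBraid_loop₂ {a b c d e f p q r p1 q1 r1 p2 q2 r2 u1 v1 w1 u2 v2 w2 u3 v3 w3
    x1 y1 z1 x2 y2 z2 : ℝ}
    (h1 : TropBraid a b c p q r) (h2 : TropBraid c e f p1 q1 r1)
    (h3 : TropBraid b d p1 p2 q2 r2) (h4 : TropBraid r d e u1 v1 w1)
    (h5 : TropBraid q v1 f u2 v2 w2) (h6 : TropBraid p u1 u2 u3 v3 w3)
    (h7 : TropBraid a q2 q1 x1 y1 z1) (h8 : TropBraid z1 r2 r1 x2 y2 z2) :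
    p2 = u3 ∧ x1 = v3 ∧ x2 = w3 ∧ y1 = v2 ∧ y2 = w2 ∧ z2 = w1 := by
  rcases h1.cases with ⟨i1, rfl, rfl, rfl⟩ | ⟨i1, rfl, rfl, rfl⟩ <;> clear h1 <;>
  rcases h2.cases with ⟨i2, rfl, rfl, rfl⟩ | ⟨i2, rfl, rfl, rfl⟩ <;> clear h2 <;>
  rcases h3.cases with ⟨i3, rfl, rfl, rfl⟩ | ⟨i3, rfl, rfl, rfl⟩ <;> clear h3 <;>
  rcases h4.cases with ⟨i4, rfl, rfl, rfl⟩ | ⟨i4, rfl, rfl, rfl⟩ <;> clear h4 <;>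
  (try (exfalso; linarith)) <;>
  rcases h5.cases with ⟨i5, rfl, rfl, rfl⟩ | ⟨i5, rfl, rfl, rfl⟩ <;> clear h5 <;>
  (try (exfalso; linarith)) <;>
  rcases h6.cases with ⟨i6, rfl, rfl, rfl⟩ | ⟨i6, rfl, rfl, rfl⟩ <;> clear h6 <;>
  (try (exfalso; linarith)) <;>
  rcases h7.cases with ⟨i7, rfl, rfl, rfl⟩ | ⟨i7, rfl, rfl, rfl⟩ <;> clear h7 <;>
  (try (exfalso; linarith)) <;>
  rcases h8.cases with ⟨i8, rfl, rfl, rfl⟩ | ⟨i8, rfl, rfl, rfl⟩ <;> clear h8 <;>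
  (try (exfalso; linarith)) <;>
  refine ⟨?_, ?_, ?_, ?_, ?_, ?_⟩ <;> linarith

/-- Elementary moves on words decorated with elements of `K`. -/
inductive BraidMove {I : Type*} (M : CoxeterMatrix I) {K : AddSubgroup ℝ} :
    List (I × K) → List (I × K) → Prop
  | comm {i j : I} (h : M i j = 2) (a b : K) (τ : List (I × K)) :
      BraidMove M ((i, a) :: (j, b) :: τ) ((j, b) :: (i, a) :: τ)
  | braid {i j : I} (h : M i j = 3) {a b c p q r : K} (hb : TropBraid a b c p q r)
      (τ : List (I × K)) :
      BraidMove M ((i, a) :: (j, b) :: (i, c) :: τ) ((j, p) :: (i, q) :: (j, r) :: τ)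
  | cons (x : I × K) {ω σ : List (I × K)} (h : BraidMove M ω σ) :
      BraidMove M (x :: ω) (x :: σ)

/-- The equivalence relation on decorated words generated by the braid moves. -/
def BraidEqv {I : Type*} (M : CoxeterMatrix I) {K : AddSubgroup ℝ} (ω ω' : List (I × K)) : Prop :=
  Relation.EqvGen (BraidMove M) ω ω'

namespace BraidEqv

variable {I : Type*} {M : CoxeterMatrix I} {K : AddSubgroup ℝ} {ω ω' ω'' : List (I × K)}

theorem refl (ω : List (I × K)) : BraidEqv M ω ω := Relation.EqvGen.refl _

theorem symm (h : BraidEqv M ω ω') : BraidEqv M ω' ω := Relation.EqvGen.symm _ _ h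

theorem trans (h : BraidEqv M ω ω') (h' : BraidEqv M ω' ω'') : BraidEqv M ω ω'' :=
  Relation.EqvGen.trans _ _ _ h h'

theorem of_move (h : BraidMove M ω ω') : BraidEqv M ω ω' := Relation.EqvGen.rel _ _ h

theorem cons (h : BraidEqv M ω ω') (x : I × K) : BraidEqv M (x :: ω) (x :: ω') := by
  induction h with
  | rel _ _ h => exact of_move (.cons x h)
  | refl => exact refl _
  | symm _ _ _ ih => exact ih.symm
  | trans _ _ _ _ _ ih ih' => exact ih.trans ih'

theorem comm {i j : I} (h : M i j = 2) {a b : K} {τ : List (I × K)} :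
    BraidEqv M ((i, a) :: (j, b) :: τ) ((j, b) :: (i, a) :: τ) :=
  of_move (.comm h a b τ)

theorem braid {i j : I} (h : M i j = 3) {a b c p q r : K} (hb : TropBraid a b c p q r)
    {τ : List (I × K)} :
    BraidEqv M ((i, a) :: (j, b) :: (i, c) :: τ) ((j, p) :: (i, q) :: (j, r) :: τ) :=
  of_move (.braid h hb τ)

theorem length_eq (h : BraidEqv M ω ω') : ω.length = ω'.length := by
  induction h with
  | rel _ _ h => induction h with
    | comm => rfl
    | braid => rfl
    | cons _ _ ih => simpa using ih
  | refl => rfl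
  | symm _ _ _ ih => exact ih.symm
  | trans _ _ _ _ _ ih ih' => exact ih.trans ih'

end BraidEqv

namespace CoxeterSystem

variable {I W : Type*} [Group W] {M : CoxeterMatrix I} (cs : CoxeterSystem M W)
variable {K : AddSubgroup ℝ}

/-- The element of `W` underlying a decorated word. -/
def decProd (ω : List (I × K)) : W := cs.wordProd (ω.map Prod.fst)

/-- A decorated word is reduced if its underlying word is. -/
def DecReduced (ω : List (I × K)) : Prop := cs.length (cs.decProd ω) = ω.length

/-- `i` is a left descent of the element underlying the decorated word `ω`. -/
def DecDescent (ω : List (I × K)) (i : I) : Prop := cs.IsLeftDescent (cs.decProd ω) i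

theorem decProd_cons (p : I × K) (ω : List (I × K)) :
    cs.decProd (p :: ω) = cs.simple p.1 * cs.decProd ω := by
  simp [decProd, wordProd_cons]

theorem decReduced_nil : cs.DecReduced ([] : List (I × K)) := by
  simp [DecReduced, decProd]

theorem length_decProd_le (ω : List (I × K)) : cs.length (cs.decProd ω) ≤ ω.length := by
  simpa [decProd] using cs.length_wordProd_le (ω.map Prod.fst)

theorem decReduced_cons_iff {p : I × K} {ω : List (I × K)} :
    cs.DecReduced (p :: ω) ↔ cs.DecReduced ω ∧ ¬ cs.DecDescent ω p.1 := by
  have h1 := cs.length_decProd_le ω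
  have h2 := cs.length_simple_mul (cs.decProd ω) p.1
  simp only [DecReduced, DecDescent, IsLeftDescent, decProd_cons, List.length_cons]
  omega

theorem DecReduced.tail {p : I × K} {ω : List (I × K)} (h : cs.DecReduced (p :: ω)) :
    cs.DecReduced ω := (cs.decReduced_cons_iff.1 h).1

theorem DecReduced.decDescent {p : I × K} {ω : List (I × K)} (h : cs.DecReduced (p :: ω)) :
    cs.DecDescent (p :: ω) p.1 := by
  have h1 : cs.length (cs.decProd ω) = ω.length := h.tail
  have h2 : cs.length (cs.decProd (p :: ω)) = ω.length + 1 := h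
  simp only [DecDescent, IsLeftDescent, decProd_cons, simple_mul_simple_cancel_left] at *
  omega

theorem _root_.BraidEqv.decProd_eq {ω ω' : List (I × K)} (h : BraidEqv M ω ω') :
    cs.decProd ω = cs.decProd ω' := by
  induction h with
  | rel _ _ h => induction h with
    | comm h => simp only [decProd_cons, ← mul_assoc, cs.simple_mul_comm h]
    | braid h => simp only [decProd_cons, ← mul_assoc, cs.simple_mul_braid h]
    | cons _ _ ih => simp only [decProd_cons, ih]
  | refl => rfl
  | symm _ _ _ ih => exact ih.symm
  | trans _ _ _ _ _ ih ih' => exact ih.trans ih'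

theorem _root_.BraidEqv.decReduced {ω ω' : List (I × K)} (h : BraidEqv M ω ω')
    (hr : cs.DecReduced ω) : cs.DecReduced ω' := by
  unfold DecReduced at *
  rw [← h.decProd_eq cs, ← h.length_eq, hr]

theorem _root_.BraidEqv.decDescent {ω ω' : List (I × K)} (h : BraidEqv M ω ω') {i : I}
    (hd : cs.DecDescent ω i) : cs.DecDescent ω' i := by
  unfold DecDescent at *
  rwa [← h.decProd_eq cs]

section

variable {cs} (hM : ∀ i j : I, i ≠ j → M i j = 2 ∨ M i j = 3)
include hM

theorem decDescent_comm_iff {i j : I} (h : M j i = 2) {a : K} {ω : List (I × K)} :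
    cs.DecDescent ((j, a) :: ω) i ↔ cs.DecDescent ω i := by
  unfold DecDescent
  rw [decProd_cons]
  exact cs.isLeftDescent_simple_mul_of_comm hM h

theorem decDescent_braid_iff {i j : I} (h : M j i = 3) {a b : K} {ω : List (I × K)} :
    cs.DecDescent ((j, a) :: (i, b) :: ω) i ↔ cs.DecDescent ω j := by
  unfold DecDescent
  rw [decProd_cons, decProd_cons]
  exact cs.isLeftDescent_simple_mul_of_braid hM h

theorem DecDescent.of_cons {i : I} {p : I × K} {ω : List (I × K)} (hr : cs.DecReduced (p :: ω))
    (hi : p.1 ≠ i) (hd : cs.DecDescent (p :: ω) i) : cs.DecDescent ω i := by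
  have h1 := hr.decDescent
  unfold DecDescent at *
  have := cs.isLeftDescent_simple_mul_of_isLeftDescent hM hi h1 hd
  rwa [decProd_cons, simple_mul_simple_cancel_left] at this

theorem exists_braidEqv_cons {i : I} {ω : List (I × K)} (hr : cs.DecReduced ω)
    (hd : cs.DecDescent ω i) : ∃ b τ, BraidEqv M ω ((i, b) :: τ) := by
  induction hn : ω.length using Nat.strong_induction_on generalizing ω i with
  | _ n ih =>
  subst hn
  match ω with
  | [] => exact absurd hd (by simp [DecDescent, decProd, not_isLeftDescent_one])
  | (j, a) :: ω₁ =>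
    by_cases hij : j = i
    · subst hij; exact ⟨a, ω₁, .refl _⟩
    obtain ⟨b, τ, h⟩ := ih _ (by simp) hr.tail (hd.of_cons hM hr hij) rfl
    rcases hM j i hij with h2 | h3
    · exact ⟨b, (j, a) :: τ, (h.cons _).trans (.comm h2)⟩
    · have hd' := (decDescent_braid_iff hM h3).1 ((h.cons _).decDescent cs hd)
      have hl := h.length_eq
      obtain ⟨c, τ', h'⟩ := ih τ.length (by simp at *; omega)
        (h.decReduced cs hr.tail).tail hd' rfl
      obtain ⟨p, q, r, hb⟩ := exists_tropBraid a b c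
      exact ⟨p, (j, q) :: (i, r) :: τ', ((h.trans (h'.cons _)).cons _).trans (.braid h3 hb)⟩

end

end CoxeterSystem

/-- `Extract M i ω b ω'`: moving a letter `i` to the front of the word `ω` turns it
into `(i, b) :: ω'`. -/
inductive Extract {I : Type*} (M : CoxeterMatrix I) {K : AddSubgroup ℝ} (i : I) :
    List (I × K) → K → List (I × K) → Prop
  | same {a : K} {ω ω' : List (I × K)} (h : BraidEqv M ω ω') : Extract M i ((i, a) :: ω) a ω'
  | comm {j : I} (hm : M j i = 2) {a b : K} {ω τ ω' : List (I × K)}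
      (h : BraidEqv M ω ((i, b) :: τ)) (h' : BraidEqv M ω' ((j, a) :: τ)) :
      Extract M i ((j, a) :: ω) b ω'
  | braid {j : I} (hm : M j i = 3) {a b c p q r : K} {ω τ ω' : List (I × K)}
      (h : BraidEqv M ω ((i, b) :: (j, c) :: τ)) (hb : TropBraid a b c p q r)
      (h' : BraidEqv M ω' ((j, q) :: (i, r) :: τ)) : Extract M i ((j, a) :: ω) p ω'

namespace Extract

variable {I W : Type*} [Group W] {M : CoxeterMatrix I} {cs : CoxeterSystem M W}
variable {K : AddSubgroup ℝ} {i : I} {b b' : K} {p : I × K} {ω ω' ω₁ ω₂ τ τ' : List (I × K)}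

theorem congr (h : Extract M i ω b τ) (hτ : BraidEqv M τ τ') : Extract M i ω b τ' := by
  cases h with
  | same h => exact .same (h.trans hτ)
  | comm hm h h' => exact .comm hm h (hτ.symm.trans h')
  | braid hm h hb h' => exact .braid hm h hb (hτ.symm.trans h')

theorem congr_tail (h : Extract M i (p :: ω₁) b τ) (hω : BraidEqv M ω₁ ω₂) :
    Extract M i (p :: ω₂) b τ := by
  cases h with
  | same h => exact .same (hω.symm.trans h)
  | comm hm h h' => exact .comm hm (hω.symm.trans h) h'
  | braid hm h hb h' => exact .braid hm (hω.symm.trans h) hb h'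

theorem of_cons {a : K} (h : Extract M i ((i, a) :: ω) b τ) : a = b ∧ BraidEqv M ω τ := by
  cases h with
  | same h => exact ⟨rfl, h⟩
  | comm hm => simp at hm
  | braid hm => simp at hm

theorem exists_extract (hM : ∀ i j : I, i ≠ j → M i j = 2 ∨ M i j = 3)
    (hr : cs.DecReduced ω) (hd : cs.DecDescent ω i) : ∃ b τ, Extract M i ω b τ := by
  match ω with
  | [] => exact absurd hd (by simp [CoxeterSystem.DecDescent, CoxeterSystem.decProd,
      CoxeterSystem.not_isLeftDescent_one])
  | (j, a) :: ω₁ =>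
    by_cases hij : j = i
    · subst hij; exact ⟨a, ω₁, .same (.refl _)⟩
    obtain ⟨b, τ, h⟩ := CoxeterSystem.exists_braidEqv_cons hM hr.tail (hd.of_cons hM hr hij)
    rcases hM j i hij with h2 | h3
    · exact ⟨b, (j, a) :: τ, .comm h2 h (.refl _)⟩
    · obtain ⟨c, τ', h'⟩ := CoxeterSystem.exists_braidEqv_cons hM (h.decReduced cs hr.tail).tail
        ((CoxeterSystem.decDescent_braid_iff hM h3).1 ((h.cons _).decDescent cs hd))
      obtain ⟨p, q, r, hb⟩ := exists_tropBraid a b c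
      exact ⟨p, _, .braid h3 (h.trans (h'.cons _)) hb (.refl _)⟩

/-- The letter and the word extracted from `ω` are unique as soon as braid equivalence can be
cancelled for shorter words. -/
theorem unique
    (ih : ∀ (j : I) (a a' : K) (σ σ' : List (I × K)), σ.length + 1 < ω.length →
      cs.DecReduced ((j, a) :: σ) → BraidEqv M ((j, a) :: σ) ((j, a') :: σ') →
      a = a' ∧ BraidEqv M σ σ') (hr : cs.DecReduced ω)
    (h₁ : Extract M i ω b τ) (h₂ : Extract M i ω b' τ') : b = b' ∧ BraidEqv M τ τ' := by
  cases h₁ with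
  | same h₁ =>
    obtain ⟨rfl, h⟩ := h₂.of_cons
    exact ⟨rfl, h₁.symm.trans h⟩
  | comm hm h₁ h₁' =>
    cases h₂ with
    | same => simp at hm
    | comm _ h₂ h₂' =>
      have hl := h₁.length_eq
      obtain ⟨rfl, h⟩ := ih _ _ _ _ _ (by simp at *; omega)
        (h₁.decReduced cs hr.tail) (h₁.symm.trans h₂)
      exact ⟨rfl, h₁'.trans ((h.cons _).trans h₂'.symm)⟩
    | braid hm' => omega
  | braid hm h₁ hb₁ h₁' =>
    cases h₂ with
    | same => simp at hm
    | comm hm' => omega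
    | braid _ h₂ hb₂ h₂' =>
      have hl := h₁.length_eq
      have hr' := h₁.decReduced cs hr.tail
      obtain ⟨rfl, h⟩ := ih _ _ _ _ _ (by simp at *; omega) hr' (h₁.symm.trans h₂)
      obtain ⟨rfl, h'⟩ := ih _ _ _ _ _ (by simp at *; omega) hr'.tail h
      obtain ⟨rfl, rfl, rfl⟩ := hb₁.unique hb₂
      exact ⟨rfl, h₁'.trans (((h'.cons _).cons _).trans h₂'.symm)⟩

end Extract

namespace CoxeterSystem

variable {I W : Type*} [Group W] {M : CoxeterMatrix I} (cs : CoxeterSystem M W)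

theorem isLeftDescent_of_braid (hM : ∀ i j : I, i ≠ j → M i j = 2 ∨ M i j = 3) {w : W} {i j : I}
    (h : M i j = 3) (hj : cs.IsLeftDescent w j) :
    cs.IsLeftDescent (cs.simple j * (cs.simple i * w)) i := by
  rw [← cs.isLeftDescent_simple_mul_of_braid hM h]
  simpa using hj

theorem not_isLeftDescent_triangle_aux (hM : ∀ i j : I, i ≠ j → M i j = 2 ∨ M i j = 3) (n : ℕ) :
    ∀ {w : W} {i j k : I}, cs.length w = n → M i j = 3 → M j k = 3 → M k i = 3 →
    cs.IsLeftDescent w j → cs.IsLeftDescent w k → ¬ cs.IsLeftDescent (cs.simple j * w) i := by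
  induction n using Nat.strong_induction_on with
  | _ n ih =>
    intro w i j k hw hij hjk hki hj hk hi
    have hne : j ≠ k := by rintro rfl; simp at hjk
    exact ih _ (hw ▸ hj) rfl hjk hki hij
      (cs.isLeftDescent_simple_mul_of_isLeftDescent hM hne hj hk) hi
      (cs.isLeftDescent_of_braid hM hjk hk)

theorem not_isLeftDescent_triangle (hM : ∀ i j : I, i ≠ j → M i j = 2 ∨ M i j = 3) {w : W}
    {i j k : I} (hij : M i j = 3) (hjk : M j k = 3) (hki : M k i = 3) (hi : cs.IsLeftDescent w i)
    (hj : cs.IsLeftDescent w j) : ¬ cs.IsLeftDescent w k := by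
  intro hk
  have hne : i ≠ j := by rintro rfl; simp at hij
  have hne' : i ≠ k := by rintro rfl; simp at hki
  exact cs.not_isLeftDescent_triangle_aux hM _ rfl hij hjk hki
    (cs.isLeftDescent_simple_mul_of_isLeftDescent hM hne hi hj)
    (cs.isLeftDescent_simple_mul_of_isLeftDescent hM hne' hi hk)
    (cs.isLeftDescent_of_braid hM hij hj)

end CoxeterSystem

namespace Extract

open CoxeterSystem

variable {I W : Type*} [Group W] {M : CoxeterMatrix I} {cs : CoxeterSystem M W}
variable {K : AddSubgroup ℝ} {i j k : I} {a b c p q r : K} {ω ω' τ : List (I × K)}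
variable (hM : ∀ i j : I, i ≠ j → M i j = 2 ∨ M i j = 3)
include hM

theorem comm_two_two (hjk : M j k = 2) (hji : M j i = 2) (hki : M k i = 2)
    (hr : cs.DecReduced ((j, a) :: (k, b) :: τ)) (hd : cs.DecDescent ((j, a) :: (k, b) :: τ) i) :
    ∃ d σ, Extract M i ((j, a) :: (k, b) :: τ) d σ ∧ Extract M i ((k, b) :: (j, a) :: τ) d σ := by
  rw [decDescent_comm_iff hM hji, decDescent_comm_iff hM hki] at hd
  obtain ⟨c, τ', h⟩ := exists_braidEqv_cons hM hr.tail.tail hd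
  exact ⟨c, _, .comm hji ((h.cons _).trans (.comm hki)) (.refl _),
    .comm hki ((h.cons _).trans (.comm hji)) (.comm hjk)⟩

theorem comm_two_three (hjk : M j k = 2) (hji : M j i = 2) (hki : M k i = 3)
    (hr : cs.DecReduced ((j, a) :: (k, b) :: τ)) (hd : cs.DecDescent ((j, a) :: (k, b) :: τ) i) :
    ∃ d σ, Extract M i ((j, a) :: (k, b) :: τ) d σ ∧ Extract M i ((k, b) :: (j, a) :: τ) d σ := by
  have hne : k ≠ i := by rintro rfl; simp at hki
  rw [decDescent_comm_iff hM hji] at hd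
  obtain ⟨c, τ₁, h₁⟩ := exists_braidEqv_cons hM hr.tail.tail (hd.of_cons hM hr.tail hne)
  obtain ⟨d, τ₂, h₂⟩ := exists_braidEqv_cons hM (h₁.decReduced cs hr.tail.tail).tail
    ((decDescent_braid_iff hM hki).1 ((h₁.cons _).decDescent cs hd))
  have h : BraidEqv M τ ((i, c) :: (k, d) :: τ₂) := h₁.trans (h₂.cons _)
  obtain ⟨p, q, r, hb⟩ := exists_tropBraid b c d
  have hkj : M k j = 2 := M.symmetric k j ▸ hjk
  have hij : M i j = 2 := M.symmetric i j ▸ hji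
  exact ⟨p, _, .comm hji ((h.cons _).trans (.braid hki hb)) (.refl _),
    .braid hki (((h.cons _).trans (.comm hji)).trans (.cons (.comm hjk) _)) hb
      ((BraidEqv.comm hjk).trans (.cons (.comm hji) _))⟩

theorem comm_three_three (hjk : M j k = 2) (hji : M j i = 3) (hki : M k i = 3)
    (hr : cs.DecReduced ((j, a) :: (k, b) :: τ)) (hd : cs.DecDescent ((j, a) :: (k, b) :: τ) i) :
    ∃ d σ, Extract M i ((j, a) :: (k, b) :: τ) d σ ∧ Extract M i ((k, b) :: (j, a) :: τ) d σ := by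
  have hki' : k ≠ i := by rintro rfl; simp at hki
  have hji' : j ≠ i := by rintro rfl; simp at hji
  have hkj : M k j = 2 := M.symmetric k j ▸ hjk
  have hik : M i k = 3 := M.symmetric i k ▸ hki
  have hij : M i j = 3 := M.symmetric i j ▸ hji
  have hd₁ := hd.of_cons hM hr hji'
  have hd₂ := ((BraidEqv.comm hjk).decDescent cs hd).of_cons hM
    ((BraidEqv.comm hjk).decReduced cs hr) hki'
  obtain ⟨c, τ₁, h₁⟩ := exists_braidEqv_cons hM hr.tail.tail (hd₁.of_cons hM hr.tail hki')
  have hr₁ := (h₁.decReduced cs hr.tail.tail).tail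
  obtain ⟨d, τ₂, h₂⟩ := exists_braidEqv_cons hM hr₁
    ((decDescent_braid_iff hM hji).1 ((h₁.cons _).decDescent cs hd₂))
  have hr₂ := (h₂.decReduced cs hr₁).tail
  obtain ⟨e, τ₃, h₃⟩ := exists_braidEqv_cons hM hr₂ ((decDescent_comm_iff hM hjk).1
    (h₂.decDescent cs ((decDescent_braid_iff hM hki).1 ((h₁.cons _).decDescent cs hd₁))))
  have hr₃ := (h₃.decReduced cs hr₂).tail
  have h' : BraidEqv M τ ((i, c) :: (j, d) :: (k, e) :: τ₃) :=
    h₁.trans ((h₂.trans (h₃.cons _)).cons _)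
  obtain ⟨u, v, w, hb⟩ := exists_tropBraid a c d
  have hd₃ : cs.DecDescent τ₃ i := by
    have := (BraidEqv.trans ((h'.cons _).cons _)
      ((BraidEqv.comm hjk).trans ((BraidEqv.braid hji hb).cons _))).decDescent cs hd
    rwa [decDescent_braid_iff hM hki, decDescent_comm_iff hM hjk,
      decDescent_braid_iff hM hik] at this
  obtain ⟨f, τ₄, h₄⟩ := exists_braidEqv_cons hM hr₃ hd₃
  have h : BraidEqv M τ ((i, c) :: (j, d) :: (k, e) :: (i, f) :: τ₄) :=
    h'.trans (((h₄.cons _).cons _).cons _)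
  obtain ⟨p1, q1, r1, b1⟩ := exists_tropBraid b c e
  obtain ⟨p2, q2, r2, b2⟩ := exists_tropBraid r1 d f
  obtain ⟨p3, q3, r3, b3⟩ := exists_tropBraid a p1 p2
  obtain ⟨u1, v1, w1, b4⟩ := exists_tropBraid a c d
  obtain ⟨u2, v2, w2, b5⟩ := exists_tropBraid w1 e f
  obtain ⟨u3, v3, w3, b6⟩ := exists_tropBraid b u1 u2
  obtain ⟨x1, y1, z1, b7⟩ := exists_tropBraid r3 q1 q2
  obtain ⟨x2, y2, z2, b8⟩ := exists_tropBraid q3 y1 r2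
  obtain ⟨t1, t2, t3, t4, t5, t6⟩ := tropBraid_loop₁ b1 b2 b3 b4 b5 b6 b7 b8
  simp only [Subtype.coe_inj] at t1 t2 t3 t4 t5 t6
  subst t1 t2 t3 t4 t5 t6
  refine ⟨p3, (j, q3) :: (i, r3) :: (k, q1) :: (i, q2) :: (j, r2) :: τ₄,
    .braid (τ := (k, q1) :: (i, q2) :: (j, r2) :: τ₄) (c := p2) hji ?_ b3 (.refl _),
    .braid (τ := (j, y2) :: (i, z2) :: (k, z1) :: τ₄) (c := u2) hki ?_ b6 ?_⟩
  · refine (h.cons _).trans (((BraidEqv.comm hjk).cons _).cons _ |>.trans ?_)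
    refine (BraidEqv.braid hki b1).trans (BraidEqv.cons ?_ _)
    refine ((BraidEqv.braid hij b2).cons _).trans ?_
    exact BraidEqv.comm hkj
  · refine (h.cons _).trans ((BraidEqv.braid hji b4).trans (BraidEqv.cons ?_ _))
    refine ((BraidEqv.braid hik b5).cons _).trans ?_
    exact BraidEqv.comm hjk
  · refine ((BraidEqv.braid hik b7).cons _).trans ((BraidEqv.comm hjk).trans (BraidEqv.cons ?_ _))
    refine (((BraidEqv.comm hkj).cons _).cons _).trans ?_
    exact BraidEqv.braid hji b8

theorem braid_two_two (hjk : M j k = 3) (hji : M j i = 2) (hki : M k i = 2)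
    (hb : TropBraid a b c p q r) (hr : cs.DecReduced ((j, a) :: (k, b) :: (j, c) :: τ))
    (hd : cs.DecDescent ((j, a) :: (k, b) :: (j, c) :: τ) i) :
    ∃ d σ, Extract M i ((j, a) :: (k, b) :: (j, c) :: τ) d σ ∧
      Extract M i ((k, p) :: (j, q) :: (k, r) :: τ) d σ := by
  rw [decDescent_comm_iff hM hji, decDescent_comm_iff hM hki, decDescent_comm_iff hM hji] at hd
  obtain ⟨d, τ', h⟩ := exists_braidEqv_cons hM hr.tail.tail.tail hd
  refine ⟨d, _, .comm hji (τ := (k, b) :: (j, c) :: τ') ?_ (.refl _),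
    .comm hki (τ := (j, q) :: (k, r) :: τ') ?_ (.braid hjk hb)⟩
  · exact ((h.cons _).cons _).trans (((BraidEqv.comm hji).cons _).trans (.comm hki))
  · exact ((h.cons _).cons _).trans (((BraidEqv.comm hki).cons _).trans (.comm hji))

theorem braid_two_three (hjk : M j k = 3) (hji : M j i = 2) (hki : M k i = 3)
    (hb : TropBraid a b c p q r) (hr : cs.DecReduced ((j, a) :: (k, b) :: (j, c) :: τ))
    (hd : cs.DecDescent ((j, a) :: (k, b) :: (j, c) :: τ) i) :
    ∃ d σ, Extract M i ((j, a) :: (k, b) :: (j, c) :: τ) d σ ∧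
      Extract M i ((k, p) :: (j, q) :: (k, r) :: τ) d σ := by
  have hki' : k ≠ i := by rintro rfl; simp at hki
  have hkj : M k j = 3 := M.symmetric k j ▸ hjk
  have hik : M i k = 3 := M.symmetric i k ▸ hki
  have hij : M i j = 2 := M.symmetric i j ▸ hji
  have hd₁ := (decDescent_comm_iff hM hji).1 hd
  have hd₂ := (decDescent_comm_iff hM hji).1 (hd₁.of_cons hM hr.tail hki')
  obtain ⟨d, τ₁, h₁⟩ := exists_braidEqv_cons hM hr.tail.tail.tail hd₂
  have h₁' : BraidEqv M ((j, c) :: τ) ((i, d) :: (j, c) :: τ₁) := (h₁.cons _).trans (.comm hji)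
  have hr₁ := (h₁'.decReduced cs hr.tail.tail).tail
  have hd₃ : cs.DecDescent ((j, c) :: τ₁) k :=
    (decDescent_braid_iff hM hki).1 ((h₁'.cons _).decDescent cs hd₁)
  have hjk' : j ≠ k := by rintro rfl; simp at hjk
  obtain ⟨e, τ₂, h₂⟩ := exists_braidEqv_cons hM hr₁.tail (hd₃.of_cons hM hr₁ hjk')
  obtain ⟨f, τ₃, h₃⟩ := exists_braidEqv_cons hM (h₂.decReduced cs hr₁.tail).tail
    ((decDescent_braid_iff hM hjk).1 ((h₂.cons _).decDescent cs hd₃))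
  have h : BraidEqv M τ ((i, d) :: (k, e) :: (j, f) :: τ₃) :=
    h₁.trans ((h₂.trans (h₃.cons _)).cons _)
  obtain ⟨p1, q1, r1, b1⟩ := exists_tropBraid c e f
  obtain ⟨p2, q2, r2, b2⟩ := exists_tropBraid b d p1
  obtain ⟨u1, v1, w1, b3⟩ := exists_tropBraid r d e
  obtain ⟨u2, v2, w2, b4⟩ := exists_tropBraid q v1 f
  obtain ⟨u3, v3, w3, b5⟩ := exists_tropBraid p u1 u2
  obtain ⟨x1, y1, z1, b6⟩ := exists_tropBraid a q2 q1
  obtain ⟨x2, y2, z2, b7⟩ := exists_tropBraid z1 r2 r1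
  obtain ⟨t1, t2, t3, t4, t5, t6⟩ := tropBraid_loop₂ hb b1 b2 b3 b4 b5 b6 b7
  simp only [Subtype.coe_inj] at t1 t2 t3 t4 t5 t6
  subst t1 t2 t3 t4 t5 t6
  refine ⟨p2, (j, a) :: (k, q2) :: (i, r2) :: (j, q1) :: (k, r1) :: τ₃,
    .comm (τ := (k, q2) :: (i, r2) :: (j, q1) :: (k, r1) :: τ₃) hji ?_ (.refl _),
    .braid (τ := (j, y1) :: (k, y2) :: (i, z2) :: τ₃) (c := u2) hki ?_ b5 ?_⟩
  · refine ((h.cons _).cons _).trans (((BraidEqv.comm hji).cons _).trans ?_)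
    refine (((BraidEqv.braid hjk b1).cons _).cons _).trans ?_
    exact BraidEqv.braid hki b2
  · refine ((h.cons _).cons _).trans (((BraidEqv.braid hki b3).cons _).trans ?_)
    refine (BraidEqv.comm hji).trans (BraidEqv.cons ?_ _)
    refine (((BraidEqv.comm hij).cons _).cons _).trans ?_
    exact BraidEqv.braid hjk b4
  · refine (((BraidEqv.comm hij).cons _).cons _).trans ?_
    refine (BraidEqv.braid hjk b6).trans (BraidEqv.cons ?_ _)
    refine ((BraidEqv.braid hki b7).cons _).trans ?_
    exact BraidEqv.comm hji

end Extract

namespace Extract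

open CoxeterSystem

variable {I W : Type*} [Group W] {M : CoxeterMatrix I} {cs : CoxeterSystem M W}
variable {K : AddSubgroup ℝ} {i : I} {ω ω' : List (I × K)}

theorem exists_of_braidMove (hM : ∀ i j : I, i ≠ j → M i j = 2 ∨ M i j = 3)
    (h : BraidMove M ω ω') (hr : cs.DecReduced ω) (hd : cs.DecDescent ω i) :
    ∃ b τ, Extract M i ω b τ ∧ Extract M i ω' b τ := by
  cases h with
  | cons x h =>
    obtain ⟨b, τ, hτ⟩ := exists_extract hM hr hd
    exact ⟨b, τ, hτ, hτ.congr_tail (.of_move h)⟩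
  | @comm j k hjk a b τ =>
    have hkj : M k j = 2 := M.symmetric k j ▸ hjk
    by_cases hji : j = i
    · subst hji
      exact ⟨a, _, .same (.refl _), .comm hkj (.refl _) (.refl _)⟩
    by_cases hki : k = i
    · subst hki
      exact ⟨b, _, .comm hjk (.refl _) (.refl _), .same (.refl _)⟩
    rcases hM j i hji with hj | hj <;> rcases hM k i hki with hk | hk
    · exact comm_two_two hM hjk hj hk hr hd
    · exact comm_two_three hM hjk hj hk hr hd
    · obtain ⟨d, σ, h₁, h₂⟩ := comm_two_three hM hkj hk hj
        ((BraidEqv.comm hjk).decReduced cs hr) ((BraidEqv.comm hjk).decDescent cs hd)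
      exact ⟨d, σ, h₂, h₁⟩
    · exact comm_three_three hM hjk hj hk hr hd
  | @braid j k hjk a b c p q r hb τ =>
    have hkj : M k j = 3 := M.symmetric k j ▸ hjk
    by_cases hji : j = i
    · subst hji
      exact ⟨a, _, .same (.refl _), .braid hkj (.refl _) hb.symm (.refl _)⟩
    by_cases hki : k = i
    · subst hki
      exact ⟨p, _, .braid hjk (.refl _) hb (.refl _), .same (.refl _)⟩
    have hr' := (BraidEqv.braid hjk hb).decReduced cs hr
    have hd' := (BraidEqv.braid hjk hb).decDescent cs hd
    rcases hM j i hji with hj | hj <;> rcases hM k i hki with hk | hk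
    · exact braid_two_two hM hjk hj hk hb hr hd
    · exact braid_two_three hM hjk hj hk hb hr hd
    · obtain ⟨d, σ, h₁, h₂⟩ := braid_two_three hM hkj hk hj hb.symm hr' hd'
      exact ⟨d, σ, h₂, h₁⟩
    · have hdk := (BraidEqv.braid hjk hb).symm.decDescent cs hr'.decDescent
      exact absurd hd (cs.not_isLeftDescent_triangle hM hjk hk (M.symmetric i j ▸ hj)
        hr.decDescent hdk)

end Extract

namespace BraidEqv

variable {I W : Type*} [Group W] {M : CoxeterMatrix I} (cs : CoxeterSystem M W)
variable {K : AddSubgroup ℝ}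

theorem cons_inj (hM : ∀ i j : I, i ≠ j → M i j = 2 ∨ M i j = 3) {i : I} {a b : K}
    {ω ω' : List (I × K)} (hr : cs.DecReduced ((i, a) :: ω))
    (h : BraidEqv M ((i, a) :: ω) ((i, b) :: ω')) : a = b ∧ BraidEqv M ω ω' := by
  induction hn : ω.length using Nat.strong_induction_on generalizing ω ω' i a b with
  | _ n ih =>
  subst hn
  have key : ∀ {ω₁ ω₂ : List (I × K)}, BraidEqv M ω₁ ω₂ → ω₁.length = ω.length + 1 →
      cs.DecReduced ω₁ → cs.DecDescent ω₁ i → ∃ b τ, Extract M i ω₁ b τ ∧ Extract M i ω₂ b τ := by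
    intro ω₁ ω₂ h
    induction h with
    | rel _ _ h => exact fun _ => Extract.exists_of_braidMove hM h
    | refl =>
      intro _ hr hd
      obtain ⟨b, τ, hτ⟩ := Extract.exists_extract hM hr hd
      exact ⟨b, τ, hτ, hτ⟩
    | symm x y h ih₁ =>
      intro hl hr hd
      have h' : BraidEqv M y x := BraidEqv.symm h
      obtain ⟨b, τ, h₁, h₂⟩ := ih₁ (h'.length_eq ▸ hl) (h'.decReduced cs hr) (h'.decDescent cs hd)
      exact ⟨b, τ, h₂, h₁⟩
    | trans x y z h _ ih₁ ih₂ =>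
      intro hl hr hd
      have h' : BraidEqv M x y := h
      have hl' := h'.length_eq
      have hr' := h'.decReduced cs hr
      obtain ⟨b, τ, h₁, h₂⟩ := ih₁ hl hr hd
      obtain ⟨b', τ', h₃, h₄⟩ := ih₂ (hl' ▸ hl) hr' (h'.decDescent cs hd)
      obtain ⟨rfl, h₅⟩ := Extract.unique (fun j a a' σ σ' hσ hrσ hs =>
        ih σ.length (by omega) hrσ hs rfl) hr' h₂ h₃
      exact ⟨b, τ', h₁.congr h₅, h₄⟩
  obtain ⟨c, τ, h₁, h₂⟩ := key h rfl hr hr.decDescent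
  obtain ⟨rfl, h₃⟩ := h₁.of_cons
  obtain ⟨rfl, h₄⟩ := h₂.of_cons
  exact ⟨rfl, h₃.trans h₄.symm⟩

end BraidEqv

theorem TropBraid.min_right {a b c d p q r s t u : ℝ} (h : TropBraid a b c p q r)
    (h' : TropBraid q r d s t u) : TropBraid a b (min c d) (min p s) t u := by
  unfold TropBraid
  rcases h.cases with ⟨_, rfl, rfl, rfl⟩ | ⟨_, rfl, rfl, rfl⟩ <;>
  rcases h'.cases with ⟨_, rfl, rfl, rfl⟩ | ⟨_, rfl, rfl, rfl⟩ <;>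
  grind

namespace CoxeterSystem

variable {I W : Type*} [Group W] {M : CoxeterMatrix I} (cs : CoxeterSystem M W)
variable (K : AddSubgroup ℝ)

/-- Braid equivalence on reduced decorated words. -/
def decSetoid : Setoid {ω : List (I × K) // cs.DecReduced ω} where
  r ω ω' := BraidEqv M ω.1 ω'.1
  iseqv := ⟨fun _ => .refl _, fun h => h.symm, fun h₁ h₂ => h₁.trans h₂⟩

/-- Reduced decorated words up to braid equivalence. -/
def DecClass : Type _ := Quotient (cs.decSetoid K)

variable {cs K}

/-- The class of a reduced decorated word. -/
def DecClass.mk (ω : List (I × K)) (h : cs.DecReduced ω) : cs.DecClass K :=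
  Quotient.mk (cs.decSetoid K) ⟨ω, h⟩

theorem DecClass.mk_eq_mk_iff {ω ω' : List (I × K)} {h : cs.DecReduced ω}
    {h' : cs.DecReduced ω'} : DecClass.mk ω h = DecClass.mk ω' h' ↔ BraidEqv M ω ω' :=
  Quotient.eq (r := cs.decSetoid K)

theorem exists_act (hM : ∀ i j : I, i ≠ j → M i j = 2 ∨ M i j = 3) (i : I) (a : K)
    (x : cs.DecClass K) : ∃ y : cs.DecClass K, ∀ (ω : List (I × K)) (h : cs.DecReduced ω),
      x = DecClass.mk ω h →
        (¬ cs.DecDescent ω i → ∃ h', y = DecClass.mk ((i, a) :: ω) h') ∧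
        ∀ b τ, BraidEqv M ω ((i, b) :: τ) → ∃ h', y = DecClass.mk ((i, kmin a b) :: τ) h' := by
  obtain ⟨⟨ω, hω⟩, rfl⟩ := Quotient.exists_rep x
  by_cases hd : cs.DecDescent ω i
  · obtain ⟨b, τ, hτ⟩ := exists_braidEqv_cons hM hω hd
    have hr := hτ.decReduced cs hω
    have hr' (c : K) : cs.DecReduced ((i, c) :: τ) := by
      rwa [decReduced_cons_iff] at hr ⊢
    refine ⟨DecClass.mk ((i, kmin a b) :: τ) (hr' _), fun ω' h' hx => ?_⟩
    have hx' : BraidEqv M ω ω' := DecClass.mk_eq_mk_iff.1 hx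
    refine ⟨fun hn => absurd (hx'.decDescent cs hd) hn, fun b' τ' hb' => ?_⟩
    obtain ⟨rfl, hc⟩ := BraidEqv.cons_inj cs hM hr (hτ.symm.trans (hx'.trans hb'))
    exact ⟨(hc.cons _).decReduced cs (hr' _), DecClass.mk_eq_mk_iff.2 (hc.cons _)⟩
  · refine ⟨DecClass.mk ((i, a) :: ω) (cs.decReduced_cons_iff.2 ⟨hω, hd⟩), fun ω' h' hx => ?_⟩
    have hx' : BraidEqv M ω ω' := DecClass.mk_eq_mk_iff.1 hx
    refine ⟨fun hn => ⟨cs.decReduced_cons_iff.2 ⟨h', hn⟩,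
      DecClass.mk_eq_mk_iff.2 (hx'.cons _)⟩, fun b' τ' hb' => absurd ?_ hd⟩
    exact (hx'.trans hb').symm.decDescent cs (hb'.decReduced cs h').decDescent

/-- The action of the generator `i^a` on classes of reduced decorated words. -/
noncomputable def act (hM : ∀ i j : I, i ≠ j → M i j = 2 ∨ M i j = 3) (i : I) (a : K)
    (x : cs.DecClass K) : cs.DecClass K :=
  (exists_act hM i a x).choose

section

variable (hM : ∀ i j : I, i ≠ j → M i j = 2 ∨ M i j = 3) {i j : I}
include hM

theorem act_mk_of_not {a : K} {ω : List (I × K)} (h : cs.DecReduced ω)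
    (hd : ¬ cs.DecDescent ω i) :
    act hM i a (.mk ω h) = .mk ((i, a) :: ω) (cs.decReduced_cons_iff.2 ⟨h, hd⟩) :=
  (((exists_act hM i a (.mk ω h)).choose_spec ω h rfl).1 hd).2

theorem act_mk_cons {a b : K} {τ : List (I × K)} (h : cs.DecReduced ((i, b) :: τ)) :
    act hM i a (.mk ((i, b) :: τ) h) =
      .mk ((i, kmin a b) :: τ) (cs.decReduced_cons_iff.2 (cs.decReduced_cons_iff.1 h)) :=
  (((exists_act hM i a (.mk _ h)).choose_spec _ h rfl).2 b τ (.refl _)).2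

theorem exists_eq_act {ω : List (I × K)} (h : cs.DecReduced ω) (hd : cs.DecDescent ω i) :
    ∃ (d : K) (τ : List (I × K)) (hτ : cs.DecReduced τ) (_ : ¬ cs.DecDescent τ i),
      τ.length < ω.length ∧ DecClass.mk ω h = act hM i d (.mk τ hτ) := by
  obtain ⟨d, τ, hτ⟩ := exists_braidEqv_cons hM h hd
  have hr := cs.decReduced_cons_iff.1 (hτ.decReduced cs h)
  refine ⟨d, τ, hr.1, hr.2, by simp [hτ.length_eq], ?_⟩
  rw [act_mk_of_not hM hr.1 hr.2]
  exact DecClass.mk_eq_mk_iff.2 hτ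

theorem act_act_self (a b : K) (x : cs.DecClass K) :
    act hM i a (act hM i b x) = act hM i (kmin a b) x := by
  obtain ⟨⟨ω, hω⟩, rfl⟩ := Quotient.exists_rep x
  change act hM i a (act hM i b (.mk ω hω)) = act hM i (kmin a b) (.mk ω hω)
  by_cases hd : cs.DecDescent ω i
  · obtain ⟨d, τ, hτ, hn, -, h⟩ := exists_eq_act hM hω hd
    rw [h, act_mk_of_not hM hτ hn]
    simp only [act_mk_cons]
    congr 3
    exact Subtype.ext (by simp only [coe_kmin, min_assoc])
  · rw [act_mk_of_not hM hω hd, act_mk_of_not hM hω hd, act_mk_cons]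

theorem act_comm (h : M i j = 2) (a b : K) (x : cs.DecClass K) :
    act hM i a (act hM j b x) = act hM j b (act hM i a x) := by
  obtain ⟨⟨ω, hω⟩, rfl⟩ := Quotient.exists_rep x
  change act hM i a (act hM j b (.mk ω hω)) = act hM j b (act hM i a (.mk ω hω))
  have h' : M j i = 2 := M.symmetric j i ▸ h
  induction hn : ω.length using Nat.strong_induction_on generalizing ω a b with
  | _ n ih =>
  subst hn
  by_cases hi : cs.DecDescent ω i
  · obtain ⟨d, τ, hτ, -, hl, h⟩ := exists_eq_act hM hω hi
    rw [h, act_act_self, ← ih _ hl d b τ hτ rfl, act_act_self, ih _ hl _ _ τ hτ rfl]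
  by_cases hj : cs.DecDescent ω j
  · obtain ⟨d, τ, hτ, -, hl, h⟩ := exists_eq_act hM hω hj
    rw [h, act_act_self, ih _ hl a d τ hτ rfl, act_act_self, ih _ hl _ _ τ hτ rfl]
  rw [act_mk_of_not hM hω hi, act_mk_of_not hM hω hj,
    act_mk_of_not hM _ (by rwa [decDescent_comm_iff hM h']),
    act_mk_of_not hM _ (by rwa [decDescent_comm_iff hM h])]
  exact DecClass.mk_eq_mk_iff.2 (.comm h)

theorem act_braid_of_not (h : M i j = 3) (a b c : K) {ω : List (I × K)} (hω : cs.DecReduced ω)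
    (hi : ¬ cs.DecDescent ω i) (hj : ¬ cs.DecDescent ω j) :
    ∃ hr, act hM i a (act hM j b (act hM i c (.mk ω hω))) =
      .mk ((i, a) :: (j, b) :: (i, c) :: ω) hr := by
  have hne : i ≠ j := by rintro rfl; simp at h
  have h' : M j i = 3 := M.symmetric j i ▸ h
  have hr := cs.decReduced_cons_iff (p := (i, c)).2 ⟨hω, hi⟩
  rw [act_mk_of_not hM hω hi, act_mk_of_not hM _ fun hd => hj (hd.of_cons hM hr hne),
    act_mk_of_not hM _ (by rwa [decDescent_braid_iff hM h'])]
  exact ⟨_, rfl⟩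

theorem act_braid_of_act {y : cs.DecClass K}
    (hy : ∀ a b c p q r : K, TropBraid a b c p q r →
      act hM i a (act hM j b (act hM i c y)) = act hM j p (act hM i q (act hM j r y)))
    {a b c d p q r : K} (hb : TropBraid a b c p q r) :
    act hM i a (act hM j b (act hM i c (act hM i d y))) =
      act hM j p (act hM i q (act hM j r (act hM i d y))) := by
  obtain ⟨s, t, u, hb'⟩ := exists_tropBraid q r d
  rw [act_act_self, hy _ _ _ _ _ _ hb', act_act_self]
  refine hy _ _ _ _ _ _ ?_
  simpa only [coe_kmin] using hb.min_right hb'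

theorem act_braid (h : M i j = 3) (x : cs.DecClass K) {a b c p q r : K}
    (hb : TropBraid a b c p q r) :
    act hM i a (act hM j b (act hM i c x)) = act hM j p (act hM i q (act hM j r x)) := by
  obtain ⟨⟨ω, hω⟩, rfl⟩ := Quotient.exists_rep x
  change act hM i a (act hM j b (act hM i c (.mk ω hω))) =
    act hM j p (act hM i q (act hM j r (.mk ω hω)))
  induction hn : ω.length using Nat.strong_induction_on generalizing ω a b c p q r with
  | _ n ih =>
  subst hn
  by_cases hi : cs.DecDescent ω i
  · obtain ⟨d, τ, hτ, -, hl, h⟩ := exists_eq_act hM hω hi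
    rw [h]
    exact act_braid_of_act hM (fun _ _ _ _ _ _ hb => ih _ hl hb τ hτ rfl) hb
  by_cases hj : cs.DecDescent ω j
  · obtain ⟨d, τ, hτ, -, hl, h⟩ := exists_eq_act hM hω hj
    rw [h]
    exact (act_braid_of_act hM (fun _ _ _ _ _ _ hb => (ih _ hl hb.symm τ hτ rfl).symm)
      hb.symm).symm
  obtain ⟨hr, h₁⟩ := act_braid_of_not hM h a b c hω hi hj
  obtain ⟨hr', h₂⟩ := act_braid_of_not hM (M.symmetric j i ▸ h) p q r hω hj hi
  rw [h₁, h₂]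
  exact DecClass.mk_eq_mk_iff.2 (.braid h hb)

/-- The action of words in the generators on classes of reduced decorated words. -/
noncomputable def actHom : FreeMonoid (I × K) →* Function.End (cs.DecClass K) :=
  FreeMonoid.lift fun p => act hM p.1 p.2

theorem conGen_le_ker_actHom :
    conGen (UKRel M K) ≤ Con.ker (actHom (cs := cs) (K := K) hM) := by
  refine Con.conGen_le.2 fun x y h => ?_
  rw [Con.ker_rel]
  cases h with
  | comm i j h a b =>
    simp only [actHom, map_mul]
    exact funext fun x => act_comm hM h a b x
  | braid i j h a b c =>
    simp only [actHom, map_mul]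
    exact funext fun x => act_braid hM h x (tropBraid_kmin a b c)
  | idem i a b =>
    simp only [actHom, map_mul]
    exact funext fun x => act_act_self hM a b x

theorem actHom_apply_nil {ω : List (I × K)} (hω : cs.DecReduced ω) :
    actHom hM (FreeMonoid.ofList ω) (.mk [] cs.decReduced_nil) = DecClass.mk ω hω := by
  induction ω with
  | nil => simp [end_one_apply]
  | cons p ω ih =>
    have h := cs.decReduced_cons_iff.1 hω
    rw [FreeMonoid.ofList_cons, map_mul, end_mul_apply, ih h.1]
    simp only [actHom]
    exact act_mk_of_not hM h.1 h.2

end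

end CoxeterSystem

theorem prodU_eq_mk' {I : Type*} (M : CoxeterMatrix I) (K : AddSubgroup ℝ) (ω : List (I × K)) :
    prodU M K ω = Con.mk' (conGen (UKRel M K)) (FreeMonoid.ofList ω) := by
  induction ω with
  | nil => exact (map_one (Con.mk' (conGen (UKRel M K)))).symm
  | cons p ω ih =>
    rw [FreeMonoid.ofList_cons, map_mul, ← ih]
    simp only [prodU, List.map_cons, List.prod_cons]
    rfl

/-- Braid equivalence is detected by the monoid `𝔘(K)`. -/
theorem BraidEqv.of_prodU_eq {I W : Type*} [Group W] {M : CoxeterMatrix I}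
    (hM : ∀ i j : I, i ≠ j → M i j = 2 ∨ M i j = 3) (cs : CoxeterSystem M W) {K : AddSubgroup ℝ}
    {ω ω' : List (I × K)} (hω : cs.DecReduced ω) (hω' : cs.DecReduced ω')
    (h : prodU M K ω = prodU M K ω') : BraidEqv M ω ω' := by
  rw [prodU_eq_mk', prodU_eq_mk'] at h
  have h' := CoxeterSystem.conGen_le_ker_actHom (cs := cs) hM ((Con.eq _).1 h)
  rw [Con.ker_rel] at h'
  rw [← CoxeterSystem.DecClass.mk_eq_mk_iff (h := hω) (h' := hω'),
    ← CoxeterSystem.actHom_apply_nil hM hω, h', CoxeterSystem.actHom_apply_nil hM hω']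

theorem BraidEqv.eq_of_map_fst_eq {I W : Type*} [Group W] {M : CoxeterMatrix I}
    (hM : ∀ i j : I, i ≠ j → M i j = 2 ∨ M i j = 3) (cs : CoxeterSystem M W) {K : AddSubgroup ℝ}
    {ω ω' : List (I × K)} (hω : cs.DecReduced ω) (h : BraidEqv M ω ω')
    (hfst : ω.map Prod.fst = ω'.map Prod.fst) : ω = ω' := by
  induction ω generalizing ω' with
  | nil => simpa using hfst
  | cons p ω ih =>
    obtain ⟨i, a⟩ := p
    match ω' with
    | [] => simp at hfst
    | (j, b) :: ω' =>
      simp only [List.map_cons, List.cons.injEq] at hfst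
      obtain ⟨rfl, hfst⟩ := hfst
      obtain ⟨rfl, hE⟩ := BraidEqv.cons_inj cs hM hω h
      rw [ih hω.tail hE hfst]

/-- **5(a), injectivity** (Lusztig, "Half circles on flag manifolds over a semifield").
For every `w ∈ W` with `ℓ(w) = n` and every reduced word `(i₁, …, i_n)` of `w`, the map
`K^n → 𝔘(K)`, `(a₁, …, a_n) ↦ i₁^{a₁} i₂^{a₂} ⋯ i_n^{a_n}`, is injective. -/
theorem f_injective
    {I W : Type*} [Finite I] [Nonempty I] [Group W] [Finite W]
    (M : CoxeterMatrix I) (hM : ∀ i j : I, i ≠ j → M i j = 2 ∨ M i j = 3)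
    (cs : CoxeterSystem M W)
    (K : AddSubgroup ℝ) (hK : K ≠ ⊥)
    (w : W) (l : List I) (hl : IsRedWord cs w l)
    (a b : List K) (ha : a.length = l.length) (hb : b.length = l.length)
    (h : prodU M K (l.zip a) = prodU M K (l.zip b)) :
    a = b := by
  have hred (c : List K) (hc : c.length = l.length) : cs.DecReduced (l.zip c) := by
    unfold CoxeterSystem.DecReduced CoxeterSystem.decProd
    rw [List.map_fst_zip hc.ge, hl.1, ← hl.2, List.length_zip, hc, min_self]
  have hE := BraidEqv.of_prodU_eq hM cs (hred a ha) (hred b hb) h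
  have hz := hE.eq_of_map_fst_eq hM cs (hred a ha)
    (by rw [List.map_fst_zip ha.ge, List.map_fst_zip hb.ge])
  rw [← List.map_snd_zip ha.le, hz, List.map_snd_zip hb.le]
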